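/- Let Δ ≥ 1, 0 ≤ x ≤ Δ and 1 ≤ y ≤ Δ be integers, and let G be a simple graph whose vertex set is partitioned into a white side and a black side, such that every edge joins a white vertex to a black vertex and every vertex has degree exactly Δ. Suppose M* is an x-maximal y-matching of G. Then there exists a labeling ℓ of the edges of G with labels from {M,P,O,X} such that an edge receives label M if and only if it belongs to M*, for every white vertex the multiset of labels of its Δ incident edges is a white configuration of Φ_Δ(x,y), and for every black vertex the multiset of labels of its Δ incident edges is a black configuration of Φ_Δ(x,y). -/

import Mathlib

/-- The four-element alphabet {M, P, O, X}. -/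
inductive Label4 where
  | M | P | O | X
deriving DecidableEq

open Label4

/-- Black configurations of Φ_Δ(x,y). -/
def blackPhi (Δ x y : ℕ) (w : Multiset Label4) : Prop :=
  (∃ s u, w = s + (M ::ₘ u) ∧ Multiset.card s = y - 1 ∧
    Multiset.card u = Δ - y ∧ ∀ l ∈ u, l ∈ ({P, O, X} : Finset Label4)) ∨
  (∃ s, w = s + Multiset.replicate (Δ - x) O ∧ Multiset.card s = x ∧
    ∀ l ∈ s, l ∈ ({O, X} : Finset Label4))

/-- White configurations of Φ_Δ(x,y). -/
def whitePhi (Δ x y : ℕ) (w : Multiset Label4) : Prop :=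
  (∃ s u, w = s + (M ::ₘ u) ∧ Multiset.card s = y - 1 ∧
    (∀ l ∈ s, l ∈ ({M, O, X} : Finset Label4)) ∧
    Multiset.card u = Δ - y ∧ ∀ l ∈ u, l ∈ ({O, X} : Finset Label4)) ∨
  (∃ s, w = s + Multiset.replicate (Δ - x) P ∧ Multiset.card s = x ∧
    ∀ l ∈ s, l ∈ ({P, X} : Finset Label4))

theorem exists_eq_add_M_cons {w : Multiset Label4} {Δ y : ℕ} (hw : Multiset.card w = Δ)
    (hM : M ∈ w) (hy : w.count M ≤ y) (hyΔ : y ≤ Δ) :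
    ∃ s u, w = s + (M ::ₘ u) ∧ Multiset.card s = y - 1 ∧ Multiset.card u = Δ - y ∧ M ∉ u := by
  have hcard : Multiset.card (w.filter (M = ·)) + Multiset.card (w.filter (¬ M = ·)) = Δ := by
    rw [← Multiset.card_add, Multiset.filter_add_not, hw]
  have hcount : Multiset.card (w.filter (M = ·)) = w.count M := by
    rw [Multiset.count_eq_card_filter_eq]
  obtain ⟨u, hu, huc⟩ : ∃ u ≤ w.filter (¬ M = ·), Multiset.card u = Δ - y := by
    simp_rw [← Multiset.mem_powersetCard]
    rw [← Multiset.card_pos_iff_exists_mem, Multiset.card_powersetCard]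
    exact Nat.choose_pos (by omega)
  have hMu : M ∉ u := fun h => (Multiset.mem_filter.1 (Multiset.mem_of_le hu h)).2 rfl
  have hle : M ::ₘ u ≤ w :=
    (Multiset.cons_le_of_notMem hMu).2 ⟨hM, hu.trans (Multiset.filter_le _ _)⟩
  refine ⟨w - (M ::ₘ u), u, (tsub_add_cancel_of_le hle).symm, ?_, huc, hMu⟩
  rw [Multiset.card_sub hle, Multiset.card_cons, hw, huc]
  omega

theorem exists_eq_add_replicate {w : Multiset Label4} {Δ x : ℕ} {a : Label4}
    (hw : Multiset.card w = Δ) (hx : x ≤ Δ) (ha : Δ - x ≤ w.count a) :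
    ∃ s, w = s + Multiset.replicate (Δ - x) a ∧ Multiset.card s = x := by
  have hle := Multiset.le_count_iff_replicate_le.1 ha
  refine ⟨w - Multiset.replicate (Δ - x) a, (tsub_add_cancel_of_le hle).symm, ?_⟩
  rw [Multiset.card_sub hle, Multiset.card_replicate, hw]
  omega

theorem whitePhi_of_M_mem {w : Multiset Label4} {Δ x y : ℕ} (hw : Multiset.card w = Δ)
    (hM : M ∈ w) (hy : w.count M ≤ y) (hyΔ : y ≤ Δ) (hP : P ∉ w) : whitePhi Δ x y w := by
  obtain ⟨s, u, rfl, hs, hu, hMu⟩ := exists_eq_add_M_cons hw hM hy hyΔ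
  refine Or.inl ⟨s, u, rfl, hs, fun l hl => ?_, hu, fun l hl => ?_⟩ <;> cases l <;> simp_all

theorem blackPhi_of_M_mem {w : Multiset Label4} {Δ x y : ℕ} (hw : Multiset.card w = Δ)
    (hM : M ∈ w) (hy : w.count M ≤ y) (hyΔ : y ≤ Δ) : blackPhi Δ x y w := by
  obtain ⟨s, u, rfl, hs, hu, hMu⟩ := exists_eq_add_M_cons hw hM hy hyΔ
  refine Or.inl ⟨s, u, rfl, hs, hu, fun l hl => ?_⟩
  cases l <;> simp_all

theorem whitePhi_of_le_count_P {w : Multiset Label4} {Δ x y : ℕ} (hw : Multiset.card w = Δ)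
    (hx : x ≤ Δ) (hP : Δ - x ≤ w.count P) (hl : ∀ l ∈ w, l = P ∨ l = X) : whitePhi Δ x y w := by
  obtain ⟨s, rfl, hs⟩ := exists_eq_add_replicate hw hx hP
  exact Or.inr ⟨s, rfl, hs, fun l h => by simpa using hl l (Multiset.mem_add.2 (Or.inl h))⟩

theorem blackPhi_of_le_count_O {w : Multiset Label4} {Δ x y : ℕ} (hw : Multiset.card w = Δ)
    (hx : x ≤ Δ) (hO : Δ - x ≤ w.count O) (hl : ∀ l ∈ w, l = O ∨ l = X) : blackPhi Δ x y w := by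
  obtain ⟨s, rfl, hs⟩ := exists_eq_add_replicate hw hx hO
  exact Or.inr ⟨s, rfl, hs, fun l h => by simpa using hl l (Multiset.mem_add.2 (Or.inl h))⟩

section Graph

variable {V : Type*} [Fintype V] [DecidableEq V] (G : SimpleGraph V) [DecidableRel G.Adj]

theorem card_filter_neighborFinset_le_count (ℓ : Sym2 V → Label4) (a : Label4) (v : V)
    (p : V → Prop) [DecidablePred p] (h : ∀ u, G.Adj v u → p u → ℓ s(v, u) = a) :
    ((G.neighborFinset v).filter p).card ≤ ((G.incidenceFinset v).val.map ℓ).count a := by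
  rw [Multiset.count_map]
  change _ ≤ ((G.incidenceFinset v).filter (fun e => a = ℓ e)).card
  refine Finset.card_le_card_of_injOn (fun u => s(v, u)) (fun u hu => ?_) ?_
  · simp only [Finset.coe_filter, Set.mem_ofPred_eq, SimpleGraph.mem_neighborFinset] at hu
    simp only [Finset.coe_filter, Set.mem_ofPred_eq, SimpleGraph.mem_incidenceFinset]
    exact ⟨(G.mk'_mem_incidenceSet_iff).2 ⟨hu.1, Or.inl rfl⟩, (h u hu.1 hu.2).symm⟩
  · intro u _ u' _ huu'
    exact Sym2.congr_right.1 huu'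

theorem forall_mem_map_incidenceFinset {ℓ : Sym2 V → Label4} {v : V} {q : Label4 → Prop}
    (h : ∀ u, G.Adj v u → q (ℓ s(v, u))) : ∀ l ∈ (G.incidenceFinset v).val.map ℓ, q l := by
  intro l hl
  obtain ⟨e, he, rfl⟩ := Multiset.mem_map.1 hl
  rw [Finset.mem_val, SimpleGraph.mem_incidenceFinset] at he
  obtain ⟨u, rfl⟩ := Sym2.mem_iff_exists.1 he.2
  exact h u he.1

theorem count_M_map_incidenceFinset {ℓ : Sym2 V → Label4} {A : Finset (Sym2 V)}
    (h : ∀ e, ℓ e = M ↔ e ∈ A) (v : V) :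
    ((G.incidenceFinset v).val.map ℓ).count M =
      ((G.incidenceFinset v).filter (fun e => e ∈ A)).card := by
  rw [Multiset.count_map]
  change ((G.incidenceFinset v).filter (fun e => M = ℓ e)).card = _
  congr 1
  ext e
  simp [← h, eq_comm]

end Graph

open Classical in
/-- The labeling induced by an edge set `A` with covered vertices `c`: edges of `A` get `M`, and any
other edge gets `P` or `O` if only its black, respectively only its white, endpoint is covered,
and `X` otherwise. -/
noncomputable def matchingLabel {V : Type*} (white : V → Bool) (A : Finset (Sym2 V))
    (c : V → Prop) (e : Sym2 V) : Label4 :=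
  if e ∈ A then M
  else if (∃ v ∈ e, white v = true ∧ ¬ c v) ∧ ∃ v ∈ e, white v = false ∧ c v then P
  else if (∃ v ∈ e, white v = true ∧ c v) ∧ ∃ v ∈ e, white v = false ∧ ¬ c v then O
  else X

theorem matchingLabel_eq_M_iff {V : Type*} (white : V → Bool) (A : Finset (Sym2 V))
    (c : V → Prop) (e : Sym2 V) : matchingLabel white A c e = M ↔ e ∈ A := by
  unfold matchingLabel
  split_ifs <;> simp_all

theorem stmt14 (Δ x y : ℕ) (hΔ : 1 ≤ Δ) (hx : x ≤ Δ) (hy1 : 1 ≤ y) (hy2 : y ≤ Δ)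
    {V : Type*} [Fintype V] [DecidableEq V]
    (G : SimpleGraph V) [DecidableRel G.Adj]
    (white : V → Bool)
    (hbip : ∀ u v : V, G.Adj u v → white u ≠ white v)
    (hreg : ∀ v : V, G.degree v = Δ)
    (Mstar : Finset (Sym2 V)) (hsub : Mstar ⊆ G.edgeFinset)
    (hpack : ∀ v : V, ((G.incidenceFinset v).filter (fun e => e ∈ Mstar)).card ≤ y)
    (hcov : ∀ v : V, (∀ e ∈ G.incidenceFinset v, e ∉ Mstar) →
      Δ - x ≤ ((G.neighborFinset v).filter
        (fun u => ∃ e ∈ G.incidenceFinset u, e ∈ Mstar)).card) :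
    ∃ ℓ : Sym2 V → Label4,
      (∀ e ∈ G.edgeFinset, (ℓ e = M ↔ e ∈ Mstar)) ∧
      (∀ v : V, white v = true →
        whitePhi Δ x y ((G.incidenceFinset v).val.map ℓ)) ∧
      (∀ v : V, white v = false →
        blackPhi Δ x y ((G.incidenceFinset v).val.map ℓ)) := by
  classical
  obtain ⟨c, hc⟩ : ∃ c : V → Prop, ∀ u, c u ↔ ∃ e ∈ G.incidenceFinset u, e ∈ Mstar :=
    ⟨_, fun _ => Iff.rfl⟩
  have hM := matchingLabel_eq_M_iff white Mstar c
  have hcard (v : V) :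
      Multiset.card ((G.incidenceFinset v).val.map (matchingLabel white Mstar c)) = Δ := by
    rw [Multiset.card_map, Finset.card_val, G.card_incidenceFinset_eq_degree, hreg]
  have hcount (v : V) := (count_M_map_incidenceFinset G hM v).trans_le (hpack v)
  have hmem {v : V} (hv : c v) :
      M ∈ (G.incidenceFinset v).val.map (matchingLabel white Mstar c) := by
    obtain ⟨e, he, heM⟩ := (hc v).1 hv
    exact Multiset.mem_map.2 ⟨e, he, (hM e).2 heM⟩
  have hout {v u : V} (hv : ¬ c v) (hvu : G.Adj v u) : s(v, u) ∉ Mstar := fun h => hv <| (hc v).2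
    ⟨s(v, u), (G.mem_incidenceFinset _ _).2 (G.mk'_mem_incidenceSet_iff.2 ⟨hvu, Or.inl rfl⟩), h⟩
  have hcovered {v : V} (hv : ¬ c v) : Δ - x ≤ ((G.neighborFinset v).filter c).card := by
    simpa only [hc] using hcov v fun e he heM => hv ((hc v).2 ⟨e, he, heM⟩)
  clear hc
  refine ⟨matchingLabel white Mstar c, fun e _ => hM e, fun v hv => ?_, fun v hv => ?_⟩
  · have hu {u : V} (h : G.Adj v u) : white u = false := by
      simpa [hv] using (hbip v u h).symm
    by_cases hcv : c v
    · refine whitePhi_of_M_mem (hcard v) (hmem hcv) (hcount v) hy2 fun hP => ?_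
      refine forall_mem_map_incidenceFinset G (q := (· ≠ P)) (fun u h => ?_) P hP rfl
      have := hu h
      simp only [matchingLabel, Sym2.mem_iff]
      split_ifs <;> simp_all
    · refine whitePhi_of_le_count_P (hcard v) hx ((hcovered hcv).trans
        (card_filter_neighborFinset_le_count G _ _ _ _ fun u h hcu => ?_))
        (forall_mem_map_incidenceFinset G fun u h => ?_)
      · simp [matchingLabel, hv, hcv, hu h, hout hcv h, hcu]
      · by_cases hcu : c u <;> simp [matchingLabel, hv, hcv, hu h, hout hcv h, hcu]
  · have hu {u : V} (h : G.Adj v u) : white u = true := by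
      simpa [hv] using (hbip v u h).symm
    by_cases hcv : c v
    · exact blackPhi_of_M_mem (hcard v) (hmem hcv) (hcount v) hy2
    · refine blackPhi_of_le_count_O (hcard v) hx ((hcovered hcv).trans
        (card_filter_neighborFinset_le_count G _ _ _ _ fun u h hcu => ?_))
        (forall_mem_map_incidenceFinset G fun u h => ?_)
      · simp [matchingLabel, hv, hcv, hu h, hout hcv h, hcu]
      · by_cases hcu : c u <;> simp [matchingLabel, hv, hcv, hu h, hout hcv h, hcu]
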